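/- arXiv:1811.12545 — 2 statements merged into one kernel-verified Lean document; each statement's English description precedes it below -/
import Mathlib

section
/- Define F : ℂ⁺ → ℂ⁺ by F(z) = z − 1/z (this is the F-transform of μ = (δ_{−1} + δ_{1})/2, corresponding to ν = δ_0 in the Nevanlinna representation). For each n ≥ 1 let μ_n be a probability measure on ℝ with ∫_ℝ (z − t)⁻¹ dμ_n(t) = √n / F^{∘n}(√n z) for all z ∈ ℂ⁺. Then for every integer n > 12288 one has sup_{x ∈ ℝ} |C_{μ_n}(x) − C_γ(x)| ≤ 200 · n^(−1/4). -/
open MeasureTheory Complex Set Filter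

/-- The arcsine distribution on ℝ with density `1/(π√(2-t²))` on `(-√2, √2)`. -/
noncomputable def arcsine : Measure ℝ :=
  MeasureTheory.volume.withDensity fun t =>
    ENNReal.ofReal (if t ^ 2 < 2 then (Real.pi * Real.sqrt (2 - t ^ 2))⁻¹ else 0)

/-- Cumulative distribution function of a Borel measure on ℝ. -/
noncomputable def cdfOf (τ : Measure ℝ) (x : ℝ) : ℝ := (τ (Set.Iic x)).toReal

/-- Along an orbit of `z ↦ z - 1/z` started on the line `Im z = 1`, the squares decrease by `2` at
every step up to an error controlled by the imaginary part. -/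
lemma iterate_sq_eq {F : ℂ → ℂ} (hF : ∀ z : ℂ, F z = z - 1 / z) {w : ℂ} (hw : w.im = 1) (k : ℕ) :
    ∃ E : ℂ, (F^[k] w) ^ 2 = w ^ 2 - 2 * k + E ∧ ‖E‖ + 1 ≤ (F^[k] w).im := by
  induction k with
  | zero => exact ⟨0, by simp, by simp [hw]⟩
  | succ k ih =>
    obtain ⟨E, hE, him⟩ := ih
    rw [Function.iterate_succ_apply']
    set Z := F^[k] w
    have hZim : 1 ≤ Z.im := by linarith [norm_nonneg E]
    have hZ : Z ≠ 0 := by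
      intro h
      norm_num [h] at hZim
    have hpos : 0 < normSq Z := normSq_pos.mpr hZ
    refine ⟨E + 1 / Z ^ 2, ?_, ?_⟩
    · rw [hF]
      have : (Z - 1 / Z) ^ 2 = Z ^ 2 - 2 + 1 / Z ^ 2 := by
        field_simp
        ring
      rw [this, hE]
      push_cast
      ring
    · have h1 : (F Z).im = Z.im + Z.im / normSq Z := by
        rw [hF, one_div, sub_im, inv_im]
        ring
      have h2 : ‖1 / Z ^ 2‖ ≤ Z.im / normSq Z := by
        rw [norm_div, norm_one, norm_pow, ← normSq_eq_norm_sq]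
        gcongr
      rw [h1]
      linarith [norm_add_le E (1 / Z ^ 2)]

lemma iterate_neg_conj {F : ℂ → ℂ} (hF : ∀ z : ℂ, F z = z - 1 / z) (k : ℕ) (w : ℂ) :
    F^[k] (-(starRingEnd ℂ) w) = -(starRingEnd ℂ) (F^[k] w) := by
  induction k with
  | zero => simp
  | succ k ih =>
    rw [Function.iterate_succ_apply', Function.iterate_succ_apply', ih, hF, hF]
    simp only [map_sub, map_div₀, map_one, div_neg]
    ring

/-- The rescaled `n`-th iterate on the line `Im z = n^(-1/2)` is close to a square root of
`x ^ 2 - 2`. -/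
lemma scaled_iterate_sq_near {F : ℂ → ℂ} (hF : ∀ z : ℂ, F z = z - 1 / z) {n : ℕ} {y x : ℝ}
    (hy0 : 0 < y) (hy1 : y ≤ 1 / 100) (hny : Real.sqrt n * y = 1) (hx : x ^ 2 ≤ 2) :
    ∃ q : ℂ, (Real.sqrt n : ℂ) / F^[n] ((Real.sqrt n : ℂ) * (x + y * I)) = q⁻¹ ∧
      0 < q.im ∧ ‖q ^ 2 - ((x ^ 2 - 2 : ℝ) : ℂ)‖ ≤ 6 * y := by
  set r := Real.sqrt n with hr
  have hr0 : 0 < r := by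
    by_contra h
    have : r * y ≤ 0 := mul_nonpos_of_nonpos_of_nonneg (not_lt.mp h) hy0.le
    linarith
  have hrn : r ^ 2 = n := Real.sq_sqrt (Nat.cast_nonneg n)
  have hyr : y = 1 / r := by
    field_simp
    linarith
  set w : ℂ := (r : ℂ) * (x + y * I) with hwdef
  have hwim : w.im = 1 := by simp [hwdef, hny]
  obtain ⟨E, hE, him⟩ := iterate_sq_eq hF hwim n
  set Z := F^[n] w
  have hrC : (r : ℂ) ≠ 0 := by exact_mod_cast hr0.ne'
  have hwsq : ‖w‖ ^ 2 = n * x ^ 2 + 1 := by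
    rw [← normSq_eq_norm_sq, normSq_apply, hwim]
    have : w.re = r * x := by simp [hwdef]
    rw [this, ← hrn]
    ring
  have hZE : ‖E‖ ≤ ‖Z‖ := by
    have := Complex.abs_im_le_norm Z
    linarith [le_abs_self Z.im]
  have hr100 : 100 ≤ r := by
    have : r * y ≤ r * (1 / 100) := by gcongr
    linarith
  have hZ : ‖Z‖ ≤ 3 * r := by
    have h1 : ‖Z‖ ^ 2 ≤ 4 * r ^ 2 + 1 + ‖Z‖ := by
      calc ‖Z‖ ^ 2 = ‖w ^ 2 - 2 * n + E‖ := by rw [← norm_pow, hE]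
        _ ≤ ‖w ^ 2‖ + ‖(2 * n : ℂ)‖ + ‖E‖ := by
            refine (norm_add_le _ _).trans ?_
            gcongr
            exact norm_sub_le _ _
        _ ≤ 4 * r ^ 2 + 1 + ‖Z‖ := by
            rw [norm_pow, hwsq]
            have : ‖(2 * n : ℂ)‖ = 2 * n := by simp
            rw [this, ← hrn]
            nlinarith
    by_contra! h
    nlinarith
  refine ⟨Z / r, by rw [inv_div], ?_, ?_⟩
  · rw [div_ofReal_im]
    have := norm_nonneg E
    exact div_pos (by linarith) hr0
  · have hq : (Z / r) ^ 2 - ((x ^ 2 - 2 : ℝ) : ℂ) = 2 * x * y * I - (y : ℂ) ^ 2 + E / (r : ℂ) ^ 2 := by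
      have hnC : (n : ℂ) = (r : ℂ) ^ 2 := by exact_mod_cast hrn.symm
      rw [div_pow, hE, hwdef, hnC]
      push_cast
      field_simp
      ring_nf
      rw [I_sq]
      ring
    have hx2 : |x| ≤ 1.42 := abs_le_of_sq_le_sq (by norm_num; linarith) (by norm_num)
    have e1 : ‖(2 * x * y * I : ℂ)‖ ≤ 2.84 * y := by
      have : ‖(2 * x * y * I : ℂ)‖ = 2 * |x| * y := by simp [abs_of_pos hy0]
      rw [this]
      nlinarith
    have e2 : ‖(y : ℂ) ^ 2‖ ≤ 0.01 * y := by
      have : ‖(y : ℂ) ^ 2‖ = y ^ 2 := by simp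
      rw [this]
      nlinarith
    have e3 : ‖E / (r : ℂ) ^ 2‖ ≤ 3 * y := by
      have : ‖E / (r : ℂ) ^ 2‖ = ‖E‖ / r ^ 2 := by simp
      rw [this, hyr, div_le_iff₀ (by positivity)]
      have : 3 * (1 / r) * r ^ 2 = 3 * r := by field_simp
      linarith
    rw [hq]
    calc _ ≤ ‖(2 * x * y * I : ℂ)‖ + ‖(y : ℂ) ^ 2‖ + ‖E / (r : ℂ) ^ 2‖ := by
          refine (norm_add_le _ _).trans ?_
          gcongr
          exact norm_sub_le _ _
      _ ≤ 6 * y := by linarith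

/-- If `q ^ 2` is close to `-b ^ 2` and `q` lies in the upper half-plane, then `q⁻¹` is close
to `(b i)⁻¹`. -/
lemma abs_im_inv_add_le {q : ℂ} {b δ : ℝ} (hb : 0 < b) (hq : 0 < q.im)
    (h : ‖q ^ 2 - ((-b ^ 2 : ℝ) : ℂ)‖ ≤ δ) (hδ : 2 * δ ≤ b ^ 2) :
    |q⁻¹.im + b⁻¹| ≤ 3 / 2 * δ / b ^ 3 := by
  have hq0 : q ≠ 0 := by
    intro h0
    simp [h0] at hq
  have hbC : (b : ℂ) ≠ 0 := by exact_mod_cast hb.ne'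
  have hs0 : (b * I : ℂ) ≠ 0 := mul_ne_zero hbC I_ne_zero
  have him : q⁻¹.im + b⁻¹ = (q⁻¹ - (b * I : ℂ)⁻¹).im := by
    rw [sub_im, mul_inv, inv_I]
    simp [← ofReal_inv]
  have hsum : b ≤ ‖q + b * I‖ := by
    have h1 := Complex.abs_im_le_norm (q + b * I)
    have h2 : (q + b * I).im = q.im + b := by simp
    rw [h2] at h1
    linarith [le_abs_self (q.im + b)]
  have hsum0 : q + b * I ≠ 0 := norm_pos_iff.mp (hb.trans_le hsum)
  have hqn : 2 / 3 * b ≤ ‖q‖ := by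
    have h1 : b ^ 2 ≤ ‖q‖ ^ 2 + δ := by
      calc b ^ 2 = ‖q ^ 2 - (q ^ 2 - ((-b ^ 2 : ℝ) : ℂ))‖ := by simp
        _ ≤ ‖q‖ ^ 2 + δ := by
          refine (norm_sub_le _ _).trans ?_
          rw [norm_pow]
          gcongr
    by_contra! h2
    nlinarith [norm_nonneg q]
  have key : q⁻¹ - (b * I : ℂ)⁻¹ =
      -(q ^ 2 - ((-b ^ 2 : ℝ) : ℂ)) / (q * (b * I) * (q + b * I)) := by
    field_simp
    push_cast
    ring_nf
    rw [I_sq]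
    ring
  rw [him]
  refine (Complex.abs_im_le_norm _).trans ?_
  rw [key, norm_div, norm_neg, norm_mul, norm_mul]
  have hbI : ‖(b * I : ℂ)‖ = b := by simp [abs_of_pos hb]
  rw [hbI]
  have hδ0 : 0 ≤ δ := (norm_nonneg _).trans h
  calc _ ≤ δ / (2 / 3 * b * b * b) := by gcongr
    _ = 3 / 2 * δ / b ^ 3 := by
      field_simp

/-- The explicit cumulative distribution function of the arcsine distribution. -/
noncomputable def arcsineCDF (x : ℝ) : ℝ := 1 / 2 + Real.arcsin (x / √2) / Real.pi

lemma arcsineCDF_mono : Monotone arcsineCDF := by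
  intro a b h
  unfold arcsineCDF
  have := Real.pi_pos
  gcongr

lemma arcsineCDF_neg (x : ℝ) : arcsineCDF (-x) = 1 - arcsineCDF x := by
  simp only [arcsineCDF, neg_div, Real.arcsin_neg]
  ring

lemma arcsineCDF_nonneg (x : ℝ) : 0 ≤ arcsineCDF x := by
  have h := Real.neg_pi_div_two_le_arcsin (x / √2)
  have := Real.pi_pos
  have : -(1 / 2) ≤ Real.arcsin (x / √2) / Real.pi := by
    rw [le_div_iff₀ this]
    linarith
  unfold arcsineCDF
  linarith

lemma arcsineCDF_le_one (x : ℝ) : arcsineCDF x ≤ 1 := by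
  have := arcsineCDF_nonneg (-x)
  rw [arcsineCDF_neg] at this
  linarith

lemma arcsineCDF_of_le {x : ℝ} (hx : x ≤ -√2) : arcsineCDF x = 0 := by
  have : Real.arcsin (x / √2) = -(Real.pi / 2) := by
    apply Real.arcsin_of_le_neg_one
    rw [div_le_iff₀ (by positivity)]
    linarith
  rw [arcsineCDF, this]
  field_simp
  ring

lemma arcsineCDF_of_ge {x : ℝ} (hx : √2 ≤ x) : arcsineCDF x = 1 := by
  have := arcsineCDF_of_le (x := -x) (by linarith)
  rw [arcsineCDF_neg] at this
  linarith

lemma arcsin_sub_le {a b : ℝ} (ha : -1 ≤ a) (hb : b ≤ 1) (hab : a ≤ b) :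
    Real.arcsin b - Real.arcsin a ≤ Real.pi * √((b - a) / 2) := by
  have hπ := Real.pi_pos
  set φ := Real.arcsin b
  set θ := Real.arcsin a
  have hm : θ ≤ φ := Real.monotone_arcsin hab
  have h1 := Real.neg_pi_div_two_le_arcsin a
  have h2 := Real.arcsin_le_pi_div_two b
  set d := (φ - θ) / 2 with hd
  have hd0 : 0 ≤ d := by linarith
  have hdle : d ≤ Real.pi / 2 := by linarith
  have hsin : 2 / Real.pi * d ≤ Real.sin d := Real.mul_le_sin hd0 hdle
  have hcos : Real.sin d ≤ Real.cos ((φ + θ) / 2) := by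
    rw [← Real.cos_pi_div_two_sub]
    rw [← Real.cos_abs ((φ + θ) / 2)]
    apply Real.cos_le_cos_of_nonneg_of_le_pi (abs_nonneg _) (by linarith)
    rw [abs_le]
    constructor <;> linarith
  have hdiff : b - a = 2 * Real.sin d * Real.cos ((φ + θ) / 2) := by
    rw [← Real.sin_sub_sin, Real.sin_arcsin (by linarith) hb, Real.sin_arcsin ha (by linarith)]
  have hpos : 0 ≤ 2 / Real.pi * d := by positivity
  have hle : (2 / Real.pi * d) ^ 2 ≤ (b - a) / 2 := by
    rw [hdiff]
    nlinarith
  have := Real.le_sqrt_of_sq_le hle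
  calc φ - θ = Real.pi * (2 / Real.pi * d) := by
        rw [hd]
        field_simp
    _ ≤ _ := by gcongr

lemma arcsineCDF_sub_le {a b : ℝ} (hab : a ≤ b) : arcsineCDF b - arcsineCDF a ≤ √(b - a) := by
  have hπ := Real.pi_pos
  have h2 : (0 : ℝ) < √2 := by positivity
  have h1 : (1 : ℝ) ≤ √2 := Real.one_le_sqrt.mpr (by norm_num)
  have proj : ∀ x, Real.arcsin (x / √2) = Real.arcsin (max (-1) (min 1 (x / √2))) := by
    intro x
    rw [← Real.arcsin_projIcc, Set.coe_projIcc]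
  have hclamp : max (-1) (min 1 (b / √2)) - max (-1) (min 1 (a / √2)) ≤ b - a := by
    have h3 : b / √2 - a / √2 ≤ b - a := by
      rw [← sub_div]
      exact div_le_self (by linarith) h1
    have h4 : a / √2 ≤ b / √2 := by gcongr
    rcases max_cases (-1) (min 1 (b / √2)) with h | h <;>
    rcases max_cases (-1) (min 1 (a / √2)) with h' | h' <;>
    rcases min_cases 1 (b / √2) with h'' | h'' <;>
    rcases min_cases 1 (a / √2) with h''' | h''' <;> linarith
  have key := arcsin_sub_le (a := max (-1) (min 1 (a / √2))) (b := max (-1) (min 1 (b / √2)))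
    (le_max_left _ _) (max_le (by norm_num) (min_le_left _ _)) (by gcongr)
  rw [← proj, ← proj] at key
  have : √((max (-1) (min 1 (b / √2)) - max (-1) (min 1 (a / √2))) / 2) ≤ √(b - a) := by
    apply Real.sqrt_le_sqrt
    have : (max (-1) (min 1 (a / √2))) ≤ max (-1) (min 1 (b / √2)) := by gcongr
    linarith
  have e : arcsineCDF b - arcsineCDF a = (Real.arcsin (b / √2) - Real.arcsin (a / √2)) / Real.pi := by
    unfold arcsineCDF
    ring
  rw [e, div_le_iff₀ hπ]
  nlinarith

lemma abs_arcsineCDF_sub_le (a b : ℝ) : |arcsineCDF b - arcsineCDF a| ≤ √|b - a| := by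
  rcases le_total a b with h | h
  · rw [abs_of_nonneg (sub_nonneg.mpr (arcsineCDF_mono h)), abs_of_nonneg (sub_nonneg.mpr h)]
    exact arcsineCDF_sub_le h
  · rw [abs_sub_comm, abs_sub_comm b,
      abs_of_nonneg (sub_nonneg.mpr (arcsineCDF_mono h)), abs_of_nonneg (sub_nonneg.mpr h)]
    exact arcsineCDF_sub_le h

lemma continuous_arcsineCDF : Continuous arcsineCDF := by
  unfold arcsineCDF
  fun_prop

lemma hasDerivAt_arcsineCDF {x : ℝ} (hx : x ^ 2 < 2) :
    HasDerivAt arcsineCDF ((Real.pi * √(2 - x ^ 2))⁻¹) x := by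
  have h2 : (0 : ℝ) < √2 := by positivity
  have habs : |x / √2| < 1 := by
    rw [abs_div, abs_of_pos h2, div_lt_one h2]
    exact Real.lt_sqrt_of_sq_lt (by rwa [sq_abs])
  rw [abs_lt] at habs
  have h := ((Real.hasDerivAt_arcsin habs.1.ne' habs.2.ne).comp x
    ((hasDerivAt_id x).div_const (√2))).div_const Real.pi |>.const_add (1 / 2)
  refine h.congr_deriv ?_
  have hs : √(1 - (x / √2) ^ 2) = √(2 - x ^ 2) / √2 := by
    rw [← Real.sqrt_div (by linarith), div_pow, Real.sq_sqrt (by norm_num)]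
    congr 1
    ring
  have h3 : 0 < √(2 - x ^ 2) := Real.sqrt_pos.mpr (by linarith)
  have := Real.pi_pos
  rw [hs]
  field_simp

lemma arcsine_Ioc {x : ℝ} (h1 : -√2 ≤ x) (h2 : x ≤ √2) :
    arcsine (Ioc (-√2) x) = ENNReal.ofReal (arcsineCDF x) := by
  have hlt : ∀ t ∈ Ioo (-√2) x, t ^ 2 < 2 := by
    intro t ht
    have : |t| < √2 := abs_lt.mpr ⟨ht.1, ht.2.trans_le h2⟩
    have h := sq_lt_sq' (by linarith [abs_nonneg t]) this
    rwa [sq_abs, Real.sq_sqrt (by norm_num)] at h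
  set g : ℝ → ℝ := fun t => if t ^ 2 < 2 then (Real.pi * Real.sqrt (2 - t ^ 2))⁻¹ else 0 with hg
  have hg0 : ∀ t, 0 ≤ g t := by
    intro t
    have := Real.pi_pos
    simp only [hg]
    split_ifs <;> positivity
  have hder : ∀ t ∈ Ioo (-√2) x, HasDerivAt arcsineCDF (g t) t := by
    intro t ht
    simp only [hg, if_pos (hlt t ht)]
    exact hasDerivAt_arcsineCDF (hlt t ht)
  have hint : IntegrableOn g (Ioc (-√2) x) :=
    intervalIntegral.integrableOn_deriv_of_nonneg continuous_arcsineCDF.continuousOn hder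
      fun t _ => hg0 t
  have hftc := intervalIntegral.integral_eq_sub_of_hasDerivAt_of_le h1
    continuous_arcsineCDF.continuousOn hder
    ((intervalIntegrable_iff_integrableOn_Ioc_of_le h1).mpr hint)
  rw [arcsineCDF_of_le le_rfl, sub_zero, intervalIntegral.integral_of_le h1] at hftc
  rw [arcsine, withDensity_apply _ measurableSet_Ioc, ← hftc,
    ofReal_integral_eq_lintegral_ofReal hint (ae_of_all _ hg0)]

lemma arcsine_eq_zero {s : Set ℝ} (hm : MeasurableSet s) (hs : ∀ t ∈ s, 2 ≤ t ^ 2) :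
    arcsine s = 0 := by
  rw [arcsine, withDensity_apply _ hm]
  rw [setLIntegral_congr_fun (g := fun _ => 0) hm]
  · simp
  · intro t ht
    simp [not_lt.mpr (hs t ht)]

lemma cdfOf_arcsine (x : ℝ) : cdfOf arcsine x = arcsineCDF x := by
  have h0 : (0 : ℝ) ≤ √2 := by positivity
  have hsq : √2 ^ 2 = (2 : ℝ) := Real.sq_sqrt (by norm_num)
  have hlow : ∀ u ≤ -√2, arcsine (Iic u) = 0 := fun u hu =>
    arcsine_eq_zero measurableSet_Iic fun t ht => by
      have : t ≤ -√2 := le_trans ht hu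
      nlinarith
  have hmid : ∀ u, -√2 ≤ u → u ≤ √2 → arcsine (Iic u) = ENNReal.ofReal (arcsineCDF u) := by
    intro u h1 h2
    rw [← Iic_union_Ioc_eq_Iic h1, measure_union (Iic_disjoint_Ioc le_rfl) measurableSet_Ioc,
      hlow _ le_rfl, zero_add, arcsine_Ioc h1 h2]
  unfold cdfOf
  rcases le_total x (-√2) with h | h
  · rw [hlow x h, arcsineCDF_of_le h, ENNReal.toReal_zero]
  rcases le_total x (√2) with h' | h'
  · rw [hmid x h h', ENNReal.toReal_ofReal (arcsineCDF_nonneg x)]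
  · have hhigh : arcsine (Ioc (√2) x) = 0 :=
      arcsine_eq_zero measurableSet_Ioc fun t ht => by
        have := ht.1
        nlinarith
    rw [← Iic_union_Ioc_eq_Iic h', measure_union (Iic_disjoint_Ioc le_rfl) measurableSet_Ioc,
      hhigh, add_zero, hmid _ (by linarith) le_rfl, arcsineCDF_of_ge le_rfl, arcsineCDF_of_ge h']
    simp

open ProbabilityTheory in
lemma cauchyMeasure_std_eq :
    cauchyMeasure 0 1 = volume.withDensity
      (fun s : ℝ => ENNReal.ofReal (Real.pi⁻¹ * (1 + s ^ 2)⁻¹)) := by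
  rw [cauchyMeasure_of_scale_ne_zero _ one_ne_zero]
  congr 1
  ext s
  simp [cauchyPDF, cauchyPDFReal, add_comm]

/-- The cumulative distribution function of the standard Cauchy distribution. -/
noncomputable def stdCauchyCDF (v : ℝ) : ℝ := 1 / 2 + Real.arctan v / Real.pi

lemma stdCauchyCDF_mono : Monotone stdCauchyCDF := by
  intro a b h
  unfold stdCauchyCDF
  have := Real.pi_pos
  gcongr

lemma stdCauchyCDF_neg (v : ℝ) : stdCauchyCDF (-v) = 1 - stdCauchyCDF v := by
  simp only [stdCauchyCDF, Real.arctan_neg]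
  ring

lemma stdCauchyCDF_nonneg (v : ℝ) : 0 ≤ stdCauchyCDF v := by
  have h := Real.neg_pi_div_two_lt_arctan v
  have := Real.pi_pos
  have : -(1 / 2) ≤ Real.arctan v / Real.pi := by
    rw [le_div_iff₀ this]
    linarith
  unfold stdCauchyCDF
  linarith

lemma stdCauchyCDF_le_one (v : ℝ) : stdCauchyCDF v ≤ 1 := by
  have := stdCauchyCDF_nonneg (-v)
  rw [stdCauchyCDF_neg] at this
  linarith

lemma continuous_stdCauchyCDF : Continuous stdCauchyCDF := by
  unfold stdCauchyCDF
  have := Real.continuous_arctan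
  fun_prop

open ProbabilityTheory in
lemma cauchyMeasure_real_Iic (v : ℝ) : (cauchyMeasure 0 1).real (Iic v) = stdCauchyCDF v := by
  have hπ := Real.pi_pos
  rw [measureReal_def, cauchyMeasure_std_eq, withDensity_apply _ measurableSet_Iic,
    ← ofReal_integral_eq_lintegral_ofReal (integrable_inv_one_add_sq.integrableOn.const_mul _)
      (ae_of_all _ fun s => by positivity),
    ENNReal.toReal_ofReal (integral_nonneg fun s => by positivity),
    integral_const_mul, integral_Iic_inv_one_add_sq, stdCauchyCDF]
  field_simp
  ring

open ProbabilityTheory in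
lemma cauchyMeasure_real_Ioc : (cauchyMeasure 0 1).real (Ioc (-√3) (√3)) = 2 / 3 := by
  have h : (-√3 : ℝ) ≤ √3 := by linarith [Real.sqrt_nonneg 3]
  have h1 := measureReal_union (μ := cauchyMeasure 0 1) (Iic_disjoint_Ioc (a := -√3) (c := √3) le_rfl)
    measurableSet_Ioc
  rw [Iic_union_Ioc_eq_Iic h, cauchyMeasure_real_Iic, cauchyMeasure_real_Iic, stdCauchyCDF_neg,
    stdCauchyCDF, Real.arctan_sqrt_three] at h1
  have hπ := Real.pi_pos
  have h2 : Real.pi / 3 / Real.pi = 1 / 3 := by field_simp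
  rw [h2] at h1
  linarith

lemma integral_Ioi_one_add_rpow : ∫ s in Ioi (0 : ℝ), (1 + s) ^ (-(3 / 2) : ℝ) = 2 := by
  have hder : ∀ s ∈ Ici (0 : ℝ), HasDerivAt (fun s : ℝ => -2 * (1 + s) ^ (-(1 / 2) : ℝ))
      ((1 + s) ^ (-(3 / 2) : ℝ)) s := by
    intro s hs
    have hs : 0 ≤ s := hs
    have h := (((hasDerivAt_id s).const_add 1).rpow_const (p := (-(1 / 2) : ℝ))
      (Or.inl (by simp only [id]; positivity))).const_mul (-2)
    refine h.congr_deriv ?_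
    norm_num
    ring
  have hlim : Tendsto (fun s : ℝ => -2 * (1 + s) ^ (-(1 / 2) : ℝ)) atTop (nhds (-2 * 0)) :=
    ((tendsto_rpow_neg_atTop (by norm_num : (0 : ℝ) < 1 / 2)).comp
      (tendsto_atTop_add_const_left _ 1 tendsto_id)).const_mul (-2)
  rw [integral_Ioi_of_hasDerivAt_of_nonneg' hder (fun s hs => ?_) hlim]
  · norm_num
  · have hs : 0 < s := hs
    positivity

open ProbabilityTheory in
lemma sqrt_abs_cauchyMeasure :
    Integrable (fun s : ℝ => √|s|) (cauchyMeasure 0 1) ∧ ∫ s, √|s| ∂(cauchyMeasure 0 1) ≤ 3 := by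
  have hπ := Real.pi_pos
  have hb : Integrable (fun s : ℝ => 2 / Real.pi * (1 + |s|) ^ (-(3 / 2) : ℝ)) := by
    have := (integrable_one_add_norm (E := ℝ) (μ := volume) (r := 3 / 2) (by simp; norm_num)).const_mul
      (2 / Real.pi)
    simpa only [Real.norm_eq_abs] using this
  have hle : ∀ s : ℝ, (Real.pi⁻¹ * (1 + s ^ 2)⁻¹) * √|s| ≤
      2 / Real.pi * (1 + |s|) ^ (-(3 / 2) : ℝ) := by
    intro s
    set u := |s| with hu
    have hu0 : 0 ≤ u := abs_nonneg s
    have hsu : s ^ 2 = u ^ 2 := (sq_abs s).symm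
    have e : (1 + u) ^ (-(3 / 2) : ℝ) = √(1 + u) / (1 + u) ^ 2 := by
      rw [Real.sqrt_eq_rpow, ← Real.rpow_natCast, ← Real.rpow_sub (by positivity)]
      norm_num
    have e1 : √u ≤ √(1 + u) := Real.sqrt_le_sqrt (by linarith)
    have e2 : (1 + u ^ 2)⁻¹ ≤ 2 / (1 + u) ^ 2 := by
      rw [inv_eq_one_div, div_le_div_iff₀ (by positivity) (by positivity)]
      nlinarith [sq_nonneg (1 - u)]
    rw [e, hsu]
    calc Real.pi⁻¹ * (1 + u ^ 2)⁻¹ * √u ≤ Real.pi⁻¹ * (2 / (1 + u) ^ 2) * √(1 + u) := by gcongr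
      _ = _ := by ring
  have hm : Measurable fun s : ℝ => ENNReal.ofReal (Real.pi⁻¹ * (1 + s ^ 2)⁻¹) := by fun_prop
  have hr : ∀ s : ℝ, (ENNReal.ofReal (Real.pi⁻¹ * (1 + s ^ 2)⁻¹)).toReal • √|s| =
      (Real.pi⁻¹ * (1 + s ^ 2)⁻¹) * √|s| := fun s => by
    rw [ENNReal.toReal_ofReal (by positivity), smul_eq_mul]
  have hi : Integrable fun s : ℝ => (Real.pi⁻¹ * (1 + s ^ 2)⁻¹) * √|s| := by
    refine hb.mono' (by fun_prop) (ae_of_all _ fun s => ?_)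
    rw [Real.norm_of_nonneg (by positivity)]
    exact hle s
  rw [cauchyMeasure_std_eq]
  constructor
  · rw [integrable_withDensity_iff_integrable_smul' hm (ae_of_all _ fun s => ENNReal.ofReal_lt_top)]
    simpa only [hr] using hi
  · rw [integral_withDensity_eq_integral_toReal_smul hm (ae_of_all _ fun s => ENNReal.ofReal_lt_top)]
    simp only [hr]
    calc _ ≤ ∫ s : ℝ, 2 / Real.pi * (1 + |s|) ^ (-(3 / 2) : ℝ) := integral_mono hi hb hle
      _ = 8 / Real.pi := by
        rw [integral_const_mul, integral_comp_abs (f := fun s => (1 + s) ^ (-(3 / 2) : ℝ)),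
          integral_Ioi_one_add_rpow]
        ring
      _ ≤ 3 := by
        rw [div_le_iff₀ hπ]
        linarith [Real.pi_gt_three]

/-- The cumulative distribution function of `μ` convolved with the Cauchy law of scale `y`. -/
noncomputable def smoothedCDF (μ : Measure ℝ) (y x : ℝ) : ℝ := ∫ t, stdCauchyCDF ((x - t) / y) ∂μ

lemma cdfOf_mono (μ : Measure ℝ) [IsProbabilityMeasure μ] : Monotone (cdfOf μ) :=
  fun _ _ h => measureReal_mono (Iic_subset_Iic.mpr h)

open ProbabilityTheory in
lemma smoothedCDF_eq_integral_cdfOf (μ : Measure ℝ) [IsProbabilityMeasure μ] {y : ℝ} (hy : 0 < y)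
    (x : ℝ) : smoothedCDF μ y x = ∫ s, cdfOf μ (x - y * s) ∂(cauchyMeasure 0 1) := by
  set ρ := cauchyMeasure 0 1
  have hM : MeasurableSet {p : ℝ × ℝ | p.1 + y * p.2 ≤ x} :=
    measurableSet_le (by fun_prop) (by fun_prop)
  have h := (Measure.prod_apply (μ := μ) (ν := ρ) hM).symm.trans
    (Measure.prod_apply_symm (μ := μ) (ν := ρ) hM)
  have h1 : ∀ t : ℝ, Prod.mk t ⁻¹' {p : ℝ × ℝ | p.1 + y * p.2 ≤ x} = Iic ((x - t) / y) := by
    intro t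
    ext s
    simp only [mem_preimage, mem_ofPred_eq, mem_Iic]
    rw [le_div_iff₀ hy]
    constructor <;> intro <;> linarith
  have h2 : ∀ s : ℝ, (fun t => (t, s)) ⁻¹' {p : ℝ × ℝ | p.1 + y * p.2 ≤ x} = Iic (x - y * s) := by
    intro s
    ext t
    simp only [mem_preimage, mem_ofPred_eq, mem_Iic]
    constructor <;> intro <;> linarith
  simp only [h1, h2] at h
  have m1 : Measurable fun t : ℝ => ρ (Iic ((x - t) / y)) :=
    Monotone.measurable (f := fun v : ℝ => ρ (Iic v)) (fun _ _ h => measure_mono (Iic_subset_Iic.mpr h))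
      |>.comp (by fun_prop)
  have m2 : Measurable fun s : ℝ => μ (Iic (x - y * s)) :=
    Monotone.measurable (f := fun v : ℝ => μ (Iic v)) (fun _ _ h => measure_mono (Iic_subset_Iic.mpr h))
      |>.comp (by fun_prop)
  have e1 := integral_toReal m1.aemeasurable (ae_of_all μ fun t => measure_lt_top ρ _)
  have e2 := integral_toReal m2.aemeasurable (ae_of_all ρ fun t => measure_lt_top μ _)
  have e3 : smoothedCDF μ y x = ∫ t, (ρ (Iic ((x - t) / y))).toReal ∂μ := by
    unfold smoothedCDF
    congr 1
    ext t
    exact (cauchyMeasure_real_Iic _).symm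
  rw [e3, e1, h, ← e2]
  rfl

open ProbabilityTheory in
lemma le_integral_cauchyMeasure {f : ℝ → ℝ} (hf : Integrable f (cauchyMeasure 0 1)) {m Δ : ℝ}
    (hm : ∀ s ∈ Ioc (-√3) (√3), m ≤ f s) (hΔ : ∀ s, -Δ ≤ f s) :
    2 / 3 * m - 1 / 3 * Δ ≤ ∫ s, f s ∂(cauchyMeasure 0 1) := by
  set ρ := cauchyMeasure 0 1
  have hi : Integrable ((Ioc (-√3) (√3)).indicator fun _ : ℝ => m + Δ) ρ :=
    (integrable_const _).indicator measurableSet_Ioc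
  have h : ∫ s, ((Ioc (-√3) (√3)).indicator (fun _ : ℝ => m + Δ) s - Δ) ∂ρ ≤ ∫ s, f s ∂ρ := by
    refine integral_mono (hi.sub (integrable_const _)) hf fun s => ?_
    by_cases hs : s ∈ Ioc (-√3) (√3)
    · simpa [indicator_of_mem hs] using hm s hs
    · simpa [indicator_of_notMem hs] using hΔ s
  rw [integral_sub hi (integrable_const _), integral_indicator_const _ measurableSet_Ioc,
    cauchyMeasure_real_Ioc] at h
  simp only [integral_const, probReal_univ, smul_eq_mul] at h
  linarith

open ProbabilityTheory in
/-- Smoothing inequality: a bound for the Cauchy-smoothed distribution function against the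
arcsine distribution function yields a bound for the distribution function itself. -/
lemma abs_cdfOf_sub_arcsineCDF_le (μ : Measure ℝ) [IsProbabilityMeasure μ] {y ε : ℝ} (hy : 0 < y)
    (h : ∀ x, |smoothedCDF μ y x - arcsineCDF x| ≤ ε) (x : ℝ) :
    |cdfOf μ x - arcsineCDF x| ≤ 3 * ε + 13 * √y := by
  set ρ := cauchyMeasure 0 1
  set D : ℝ → ℝ := fun x => cdfOf μ x - arcsineCDF x with hD
  have hH1 : ∀ x, cdfOf μ x ≤ 1 := fun x => measureReal_le_one
  have hH0 : ∀ x, 0 ≤ cdfOf μ x := fun x => measureReal_nonneg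
  have hbdd : BddAbove (range fun x => |D x|) := by
    refine ⟨1, ?_⟩
    rintro _ ⟨x, rfl⟩
    simp only [hD, abs_le]
    constructor <;> linarith [hH1 x, hH0 x, arcsineCDF_nonneg x, arcsineCDF_le_one x]
  set Δ := ⨆ x, |D x| with hΔdef
  have hΔ : ∀ x, |D x| ≤ Δ := fun x => le_ciSup hbdd x
  have intH : ∀ x, Integrable (fun s => cdfOf μ (x - y * s)) ρ := fun x => by
    refine Integrable.of_bound ((cdfOf_mono μ).measurable.comp (by fun_prop)).aestronglyMeasurable 1
      (ae_of_all _ fun s => ?_)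
    rw [Real.norm_of_nonneg (hH0 _)]
    exact hH1 _
  have intK : ∀ x, Integrable (fun s => arcsineCDF (x - y * s)) ρ := fun x => by
    refine Integrable.of_bound (continuous_arcsineCDF.comp (by fun_prop)).aestronglyMeasurable 1
      (ae_of_all _ fun s => ?_)
    rw [Real.norm_of_nonneg (arcsineCDF_nonneg _)]
    exact arcsineCDF_le_one _
  have intD : ∀ x, Integrable (fun s => D (x - y * s)) ρ := fun x => (intH x).sub (intK x)
  have hK : ∀ x, |∫ s, arcsineCDF (x - y * s) ∂ρ - arcsineCDF x| ≤ 3 * √y := by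
    intro x
    have e : ∫ s, arcsineCDF (x - y * s) ∂ρ - arcsineCDF x =
        ∫ s, (arcsineCDF (x - y * s) - arcsineCDF x) ∂ρ := by
      rw [integral_sub (intK x) (integrable_const _)]
      simp
    rw [e]
    refine (abs_integral_le_integral_abs).trans ?_
    calc _ ≤ ∫ s, √y * √|s| ∂ρ := by
          refine integral_mono ((intK x).sub (integrable_const _)).abs
            (sqrt_abs_cauchyMeasure.1.const_mul _) fun s => ?_
          refine (abs_arcsineCDF_sub_le _ _).trans_eq ?_
          rw [← Real.sqrt_mul hy.le, sub_sub_cancel_left, abs_neg, abs_mul, abs_of_pos hy]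
      _ ≤ √y * 3 := by
          rw [integral_const_mul]
          exact mul_le_mul_of_nonneg_left sqrt_abs_cauchyMeasure.2 (Real.sqrt_nonneg y)
      _ = 3 * √y := mul_comm _ _
  have hDint : ∀ x, |∫ s, D (x - y * s) ∂ρ| ≤ ε + 3 * √y := by
    intro x
    have e : ∫ s, D (x - y * s) ∂ρ = (smoothedCDF μ y x - arcsineCDF x) -
        (∫ s, arcsineCDF (x - y * s) ∂ρ - arcsineCDF x) := by
      rw [smoothedCDF_eq_integral_cdfOf μ hy, integral_sub (intH x) (intK x)]
      ring
    rw [e]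
    exact (abs_sub _ _).trans (add_le_add (h x) (hK x))
  have h3 : √3 ^ 2 = (3 : ℝ) := Real.sq_sqrt (by norm_num)
  have h30 : (0 : ℝ) ≤ √3 := Real.sqrt_nonneg 3
  have hw : √(2 * √3 * y) ≤ 2 * √y := by
    rw [show (2 : ℝ) * √y = √(4 * y) by
      rw [Real.sqrt_mul (by norm_num), show (4 : ℝ) = 2 ^ 2 by norm_num, Real.sqrt_sq (by norm_num)]]
    apply Real.sqrt_le_sqrt
    have : √3 ≤ (2 : ℝ) := by nlinarith
    nlinarith
  have hstep : ∀ x, |D x| ≤ 3 / 2 * ε + 13 / 2 * √y + Δ / 2 := by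
    intro x
    rw [abs_le]
    constructor
    · have hx := le_integral_cauchyMeasure (f := fun s => -D (x - √3 * y - y * s))
        (intD _).neg (m := -D x - 2 * √y) (Δ := Δ) ?_ (fun s => ?_)
      · rw [integral_neg] at hx
        have := (abs_le.mp (hDint (x - √3 * y))).1
        linarith
      · intro s hs
        have hs1 : y * s ≤ y * √3 := by gcongr; exact hs.2
        have hs2 : y * -√3 ≤ y * s := by gcongr; exact hs.1.le
        have hH := cdfOf_mono μ (show x - √3 * y - y * s ≤ x by linarith)
        have hA := arcsineCDF_mono (show x - 2 * √3 * y ≤ x - √3 * y - y * s by linarith)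
        have hB := arcsineCDF_sub_le (show x - 2 * √3 * y ≤ x by nlinarith)
        rw [sub_sub_cancel] at hB
        simp only [hD]
        linarith
      · linarith [le_abs_self (D (x - √3 * y - y * s)), hΔ (x - √3 * y - y * s)]
    · have hx := le_integral_cauchyMeasure (f := fun s => D (x + √3 * y - y * s))
        (intD _) (m := D x - 2 * √y) (Δ := Δ) ?_ (fun s => ?_)
      · have := (abs_le.mp (hDint (x + √3 * y))).2
        linarith
      · intro s hs
        have hs1 : y * s ≤ y * √3 := by gcongr; exact hs.2
        have hs2 : y * -√3 ≤ y * s := by gcongr; exact hs.1.le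
        have hH := cdfOf_mono μ (show x ≤ x + √3 * y - y * s by linarith)
        have hA := arcsineCDF_mono (show x + √3 * y - y * s ≤ x + 2 * √3 * y by linarith)
        have hB := arcsineCDF_sub_le (show x ≤ x + 2 * √3 * y by nlinarith)
        rw [add_sub_cancel_left] at hB
        simp only [hD]
        linarith
      · linarith [neg_abs_le (D (x + √3 * y - y * s)), hΔ (x + √3 * y - y * s)]
  have : Δ ≤ 3 / 2 * ε + 13 / 2 * √y + Δ / 2 := ciSup_le hstep
  exact (hΔ x).trans (by linarith)

lemma smoothedCDF_mono (μ : Measure ℝ) [IsProbabilityMeasure μ] {y : ℝ} (hy : 0 < y) :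
    Monotone (smoothedCDF μ y) := by
  intro a b h
  have hi : ∀ x, Integrable (fun t => stdCauchyCDF ((x - t) / y)) μ := fun x =>
    Integrable.of_bound (continuous_stdCauchyCDF.comp (by fun_prop)).aestronglyMeasurable 1
      (ae_of_all _ fun t => by
        rw [Real.norm_of_nonneg (stdCauchyCDF_nonneg _)]
        exact stdCauchyCDF_le_one _)
  exact integral_mono (hi a) (hi b) fun t => stdCauchyCDF_mono (by gcongr)

lemma tendsto_smoothedCDF (μ : Measure ℝ) [IsProbabilityMeasure μ] {y : ℝ} {l : Filter ℝ}
    [l.IsCountablyGenerated] {c : ℝ}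
    (h : ∀ t, Tendsto (fun x => stdCauchyCDF ((x - t) / y)) l (nhds c)) :
    Tendsto (smoothedCDF μ y) l (nhds c) := by
  have := tendsto_integral_filter_of_dominated_convergence (μ := μ) (l := l)
    (F := fun x t => stdCauchyCDF ((x - t) / y)) (f := fun _ => c) (fun _ => 1)
    (Eventually.of_forall fun x =>
      (continuous_stdCauchyCDF.comp (by fun_prop)).aestronglyMeasurable)
    (Eventually.of_forall fun x => ae_of_all _ fun t => by
      rw [Real.norm_of_nonneg (stdCauchyCDF_nonneg _)]
      exact stdCauchyCDF_le_one _)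
    (integrable_const _) (ae_of_all _ h)
  change Tendsto (fun x => ∫ t, stdCauchyCDF ((x - t) / y) ∂μ) l (nhds c)
  simpa using this

lemma tendsto_stdCauchyCDF_atTop : Tendsto stdCauchyCDF atTop (nhds 1) := by
  have h := ((tendsto_nhds_of_tendsto_nhdsWithin Real.tendsto_arctan_atTop).div_const
    Real.pi).const_add (1 / 2)
  have hπ := Real.pi_pos
  have e : 1 / 2 + Real.pi / 2 / Real.pi = 1 := by
    field_simp
    norm_num
  rwa [e] at h

lemma tendsto_smoothedCDF_atTop (μ : Measure ℝ) [IsProbabilityMeasure μ] {y : ℝ} (hy : 0 < y) :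
    Tendsto (smoothedCDF μ y) atTop (nhds 1) :=
  tendsto_smoothedCDF μ fun t => tendsto_stdCauchyCDF_atTop.comp
    ((tendsto_atTop_add_const_right _ (-t) tendsto_id).atTop_div_const hy)

lemma tendsto_smoothedCDF_neg_atTop (μ : Measure ℝ) [IsProbabilityMeasure μ] {y : ℝ} (hy : 0 < y) :
    Tendsto (fun x => smoothedCDF μ y (-x)) atTop (nhds 0) := by
  suffices h0 : Tendsto (smoothedCDF μ y) atBot (nhds 0) from h0.comp tendsto_neg_atTop_atBot
  refine tendsto_smoothedCDF μ fun t => ?_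
  have h1 : Tendsto (fun x : ℝ => (t - x) / y) atBot atTop :=
    (tendsto_atTop_add_const_left _ t tendsto_neg_atBot_atTop).atTop_div_const hy
  have h := (tendsto_stdCauchyCDF_atTop.comp h1).const_sub 1
  rw [sub_self] at h
  refine h.congr fun x => ?_
  rw [Function.comp, ← stdCauchyCDF_neg, ← neg_div, neg_sub]

lemma smoothedCDF_le_one (μ : Measure ℝ) [IsProbabilityMeasure μ] {y : ℝ} (hy : 0 < y) (x : ℝ) :
    smoothedCDF μ y x ≤ 1 :=
  (smoothedCDF_mono μ hy).ge_of_tendsto (tendsto_smoothedCDF_atTop μ hy) x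

lemma hasDerivAt_smoothedCDF (μ : Measure ℝ) [IsProbabilityMeasure μ] {y : ℝ} (hy : 0 < y) (x : ℝ) :
    HasDerivAt (smoothedCDF μ y)
      (-(∫ t, ((x + y * I : ℂ) - (t : ℂ))⁻¹ ∂μ).im / Real.pi) x := by
  have hπ := Real.pi_pos
  set F' : ℝ → ℝ → ℝ := fun x t => (1 + ((x - t) / y) ^ 2)⁻¹ * (1 / y) / Real.pi with hF'
  have hder : ∀ t x, HasDerivAt (fun x => stdCauchyCDF ((x - t) / y)) (F' x t) x := by
    intro t x
    have h1 : HasDerivAt (fun x : ℝ => (x - t) / y) (1 / y) x :=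
      ((hasDerivAt_id x).sub_const t).div_const y
    exact (((Real.hasDerivAt_arctan' _).comp x h1).div_const Real.pi).const_add (1 / 2)
  have hcont : ∀ x, Continuous (F' x) := by
    intro x
    simp only [hF']
    refine ((Continuous.inv₀ (by fun_prop) fun t => ?_).mul_const _).div_const _
    positivity
  have hbound : ∀ x t, ‖F' x t‖ ≤ 1 / y / Real.pi := by
    intro x t
    simp only [hF']
    rw [Real.norm_of_nonneg (by positivity)]
    gcongr
    refine mul_le_of_le_one_left (by positivity) (inv_le_one_of_one_le₀ ?_)
    linarith [sq_nonneg ((x - t) / y)]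
  have main := (hasDerivAt_integral_of_dominated_loc_of_deriv_le (μ := μ) (s := univ) (x₀ := x)
    (F := fun x t => stdCauchyCDF ((x - t) / y)) (F' := F') (bound := fun _ => 1 / y / Real.pi)
    univ_mem
    (Eventually.of_forall fun x =>
      (continuous_stdCauchyCDF.comp (by fun_prop)).aestronglyMeasurable)
    (Integrable.of_bound (continuous_stdCauchyCDF.comp (by fun_prop)).aestronglyMeasurable 1
      (ae_of_all _ fun t => by
        rw [Real.norm_of_nonneg (stdCauchyCDF_nonneg _)]
        exact stdCauchyCDF_le_one _))
    (hcont x).aestronglyMeasurable (ae_of_all _ fun t x _ => hbound x t) (integrable_const _)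
    (ae_of_all _ fun t x _ => hder t x)).2
  refine main.congr_deriv ?_
  have hne : ∀ t : ℝ, ((x + y * I : ℂ) - (t : ℂ)) ≠ 0 := by
    intro t h0
    have := congrArg Complex.im h0
    simp at this
    exact hy.ne' this
  have him : ∀ t : ℝ, (((x + y * I : ℂ) - (t : ℂ))⁻¹).im = -(Real.pi * F' x t) := by
    intro t
    rw [inv_im, normSq_apply]
    simp only [hF', sub_im, add_im, ofReal_im, mul_im, ofReal_re, I_im, I_re, sub_re, add_re,
      mul_re]
    have hp : 0 < (x - t) ^ 2 + y ^ 2 := by positivity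
    have e1 : (1 + ((x - t) / y) ^ 2)⁻¹ * (1 / y) = y / ((x - t) ^ 2 + y ^ 2) := by
      have hp' : 0 < 1 + ((x - t) / y) ^ 2 := by positivity
      rw [mul_one_div, inv_eq_one_div, div_div, div_eq_div_iff (by positivity) hp.ne']
      field_simp
      ring
    rw [e1, mul_div_cancel₀ _ hπ.ne', neg_div]
    congr 2 <;> ring
  have hint : Integrable (fun t : ℝ => ((x + y * I : ℂ) - (t : ℂ))⁻¹) μ := by
    refine Integrable.of_bound (Continuous.inv₀ (by fun_prop) hne).aestronglyMeasurable (1 / y)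
      (ae_of_all _ fun t => ?_)
    rw [norm_inv, ← one_div]
    refine one_div_le_one_div_of_le hy ?_
    have h := Complex.abs_im_le_norm ((x + y * I : ℂ) - (t : ℂ))
    have e : ((x + y * I : ℂ) - (t : ℂ)).im = y := by simp
    rwa [e, abs_of_pos hy] at h
  have hcomm : (∫ t : ℝ, ((x + y * I : ℂ) - (t : ℂ))⁻¹ ∂μ).im =
      ∫ t : ℝ, (((x + y * I : ℂ) - (t : ℂ))⁻¹).im ∂μ :=
    (Complex.imCLM.integral_comp_comm hint).symm
  rw [hcomm]
  simp only [him]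
  rw [integral_neg, integral_const_mul]
  field_simp

/-- If the Cauchy transform is symmetric on the line `Im z = y`, so is the smoothed law. -/
lemma smoothedCDF_neg (μ : Measure ℝ) [IsProbabilityMeasure μ] {y : ℝ} (hy : 0 < y)
    (h : ∀ x : ℝ, (∫ t, (((-x : ℝ) + y * I : ℂ) - (t : ℂ))⁻¹ ∂μ).im =
      (∫ t, ((x + y * I : ℂ) - (t : ℂ))⁻¹ ∂μ).im) (x : ℝ) :
    smoothedCDF μ y (-x) = 1 - smoothedCDF μ y x := by
  set T : ℝ → ℝ := fun x => smoothedCDF μ y x + smoothedCDF μ y (-x) with hT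
  have hder : ∀ x, HasDerivAt T 0 x := by
    intro x
    have h1 := (hasDerivAt_smoothedCDF μ hy x).add
      ((hasDerivAt_smoothedCDF μ hy (-x)).comp x (hasDerivAt_neg x))
    refine h1.congr_deriv ?_
    rw [h x]
    ring
  have hconst : ∀ a, T a = T x := fun a =>
    is_const_of_deriv_eq_zero (fun a => (hder a).differentiableAt) (fun a => (hder a).deriv) a x
  have hlim : Tendsto T atTop (nhds (1 + 0)) :=
    (tendsto_smoothedCDF_atTop μ hy).add (tendsto_smoothedCDF_neg_atTop μ hy)
  have hlim2 : Tendsto T atTop (nhds (T x)) :=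
    tendsto_const_nhds.congr fun a => (hconst a).symm
  have := tendsto_nhds_unique hlim hlim2
  simp only [hT] at this
  linarith

lemma abs_smoothedCDF_sub_le_of_mem (μ : Measure ℝ) [IsProbabilityMeasure μ] {y : ℝ} (hy : 0 < y)
    (hG : ∀ x : ℝ, x ^ 2 ≤ 2 → ∃ q : ℂ, ∫ t, ((x + y * I : ℂ) - (t : ℂ))⁻¹ ∂μ = q⁻¹ ∧
      0 < q.im ∧ ‖q ^ 2 - ((x ^ 2 - 2 : ℝ) : ℂ)‖ ≤ 6 * y)
    (h0 : smoothedCDF μ y 0 = 1 / 2) {x : ℝ} (hx : x ∈ Icc 0 (√2 - 10 * y)) :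
    |smoothedCDF μ y x - arcsineCDF x| ≤ 6 * √y := by
  have hπ := Real.pi_pos
  have hπ3 := Real.pi_gt_three
  have h2 : √2 ^ 2 = (2 : ℝ) := Real.sq_sqrt (by norm_num)
  have h20 : (0 : ℝ) ≤ √2 := Real.sqrt_nonneg 2
  have h214 : (1.4 : ℝ) ≤ √2 := Real.le_sqrt_of_sq_le (by norm_num)
  have hlt : ∀ x ∈ Icc 0 (√2 - 10 * y), x ^ 2 < 2 := by
    intro x hx
    nlinarith [hx.1, hx.2]
  set f' : ℝ → ℝ := fun x => -(∫ t, ((x + y * I : ℂ) - (t : ℂ))⁻¹ ∂μ).im / Real.pi -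
    (Real.pi * √(2 - x ^ 2))⁻¹ with hf'
  have hder : ∀ x ∈ Icc 0 (√2 - 10 * y),
      HasDerivAt (fun x => smoothedCDF μ y x - arcsineCDF x) (f' x) x := fun x hx =>
    (hasDerivAt_smoothedCDF μ hy x).sub (hasDerivAt_arcsineCDF (hlt x hx))
  set B : ℝ → ℝ := fun x => 18 * y / Real.pi * (√2 - x) ^ (-(1 / 2) : ℝ) with hB
  have hBder : ∀ x ∈ Icc 0 (√2 - 10 * y),
      HasDerivAt B (9 * y / Real.pi * (√2 - x) ^ (-(3 / 2) : ℝ)) x := by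
    intro x hx
    have hu : 0 < √2 - x := by linarith [hx.2]
    have h := (((hasDerivAt_id x).const_sub (√2)).rpow_const (p := (-(1 / 2) : ℝ))
      (Or.inl (by simp only [id]; exact hu.ne'))).const_mul (18 * y / Real.pi)
    refine h.congr_deriv ?_
    norm_num
    ring
  have hbound : ∀ x ∈ Icc 0 (√2 - 10 * y),
      ‖f' x‖ ≤ 9 * y / Real.pi * (√2 - x) ^ (-(3 / 2) : ℝ) := by
    intro x hx
    have hu : 0 < √2 - x := by linarith [hx.2]
    obtain ⟨q, hq1, hq2, hq3⟩ := hG x (hlt x hx).le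
    have hpos : 0 < 2 - x ^ 2 := by linarith [hlt x hx]
    set b := √(2 - x ^ 2) with hb
    have hb0 : 0 < b := Real.sqrt_pos.mpr hpos
    have hbsq : b ^ 2 = 2 - x ^ 2 := Real.sq_sqrt hpos.le
    have e : x ^ 2 - 2 = -b ^ 2 := by linarith
    rw [e] at hq3
    have hbu : √2 - x ≤ b ^ 2 := by
      rw [hbsq]
      nlinarith [mul_nonneg hu.le (show 0 ≤ √2 + x - 1 by linarith [hx.1])]
    have hkey := abs_im_inv_add_le hb0 hq2 hq3 (by
      rw [hbsq]
      nlinarith [mul_nonneg hu.le (show 0 ≤ √2 + x - 1.4 by linarith [hx.1]), hx.2])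
    have e2 : f' x = -(q⁻¹.im + b⁻¹) / Real.pi := by
      simp only [hf']
      rw [hq1, ← hb]
      field_simp
      ring
    have e3 : (√2 - x) ^ (3 / 2 : ℝ) ≤ b ^ 3 := by
      calc (√2 - x) ^ (3 / 2 : ℝ) ≤ (b ^ 2) ^ (3 / 2 : ℝ) := by gcongr
        _ = b ^ 3 := by
          rw [← Real.rpow_natCast, ← Real.rpow_natCast, ← Real.rpow_mul hb0.le]
          norm_num
    rw [e2, Real.norm_eq_abs, abs_div, abs_neg, abs_of_pos hπ, Real.rpow_neg hu.le]
    have : 0 < (√2 - x) ^ (3 / 2 : ℝ) := by positivity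
    calc _ ≤ 3 / 2 * (6 * y) / b ^ 3 / Real.pi := by gcongr
      _ ≤ 3 / 2 * (6 * y) / (√2 - x) ^ (3 / 2 : ℝ) / Real.pi := by gcongr
      _ = _ := by
        field_simp
        ring
  have hfence := image_norm_le_of_norm_deriv_right_le_deriv_boundary'
    (f := fun x => smoothedCDF μ y x - arcsineCDF x) (f' := f') (a := 0) (b := √2 - 10 * y)
    (fun x hx => (hder x hx).continuousAt.continuousWithinAt)
    (fun x hx => (hder x (Ico_subset_Icc_self hx)).hasDerivWithinAt) (B := B) ?_
    (fun x hx => (hBder x hx).continuousAt.continuousWithinAt)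
    (fun x hx => (hBder x (Ico_subset_Icc_self hx)).hasDerivWithinAt)
    (fun x hx => hbound x (Ico_subset_Icc_self hx)) hx
  · refine hfence.trans ?_
    have hu : y ≤ √2 - x := by linarith [hx.2]
    have h1 : (√2 - x) ^ (-(1 / 2) : ℝ) ≤ y ^ (-(1 / 2) : ℝ) :=
      Real.rpow_le_rpow_of_nonpos hy hu (by norm_num)
    have h3 : y * y ^ (-(1 / 2) : ℝ) = √y := by
      rw [Real.sqrt_eq_rpow, ← Real.rpow_one_add' hy.le (by norm_num)]
      norm_num
    have hnn : 0 ≤ (√2 - x) ^ (-(1 / 2) : ℝ) := Real.rpow_nonneg (by linarith) _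
    calc B x ≤ 18 * y / 3 * y ^ (-(1 / 2) : ℝ) := by
          simp only [hB]
          gcongr
      _ = 6 * (y * y ^ (-(1 / 2) : ℝ)) := by ring
      _ = 6 * √y := by rw [h3]
  · have e : smoothedCDF μ y 0 - arcsineCDF 0 = 0 := by simp [h0, arcsineCDF]
    rw [e, norm_zero]
    have : 0 < √2 - 0 := by linarith
    simp only [hB]
    positivity

lemma abs_smoothedCDF_sub_le (μ : Measure ℝ) [IsProbabilityMeasure μ] {y : ℝ} (hy : 0 < y)
    (hy1 : y ≤ 1 / 100)
    (hG : ∀ x : ℝ, x ^ 2 ≤ 2 → ∃ q : ℂ, ∫ t, ((x + y * I : ℂ) - (t : ℂ))⁻¹ ∂μ = q⁻¹ ∧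
      0 < q.im ∧ ‖q ^ 2 - ((x ^ 2 - 2 : ℝ) : ℂ)‖ ≤ 6 * y)
    (hsymm : ∀ x : ℝ, smoothedCDF μ y (-x) = 1 - smoothedCDF μ y x) (x : ℝ) :
    |smoothedCDF μ y x - arcsineCDF x| ≤ 10 * √y := by
  wlog hx : 0 ≤ x generalizing x
  · have := this (-x) (by linarith)
    rw [hsymm, arcsineCDF_neg, abs_sub_comm] at this
    convert this using 2
    ring
  have h0 : smoothedCDF μ y 0 = 1 / 2 := by
    have := hsymm 0
    rw [neg_zero] at this
    linarith
  have hs := Real.sqrt_nonneg y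
  rcases le_total x (√2 - 10 * y) with h | h
  · exact (abs_smoothedCDF_sub_le_of_mem μ hy hG h0 ⟨hx, h⟩).trans (by linarith)
  · have h214 : (1.4 : ℝ) ≤ √2 := Real.le_sqrt_of_sq_le (by norm_num)
    have hend := abs_smoothedCDF_sub_le_of_mem μ hy hG h0
      (x := √2 - 10 * y) ⟨by linarith, le_rfl⟩
    have h1 := arcsineCDF_sub_le (show √2 - 10 * y ≤ √2 by linarith)
    rw [sub_sub_cancel, arcsineCDF_of_ge le_rfl] at h1
    have h2 : √(10 * y) ≤ 4 * √y := by
      rw [show (4 : ℝ) * √y = √(16 * y) by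
        rw [Real.sqrt_mul (by norm_num), show (16 : ℝ) = 4 ^ 2 by norm_num,
          Real.sqrt_sq (by norm_num)]]
      apply Real.sqrt_le_sqrt
      linarith
    have h3 := smoothedCDF_mono μ hy h
    have h4 := arcsineCDF_mono h
    have h5 := smoothedCDF_le_one μ hy x
    have h6 := arcsineCDF_le_one x
    rw [abs_le] at hend ⊢
    constructor <;> linarith [hend.1, hend.2]

/-- Berry–Esseen estimate for the monotone CLT for the symmetric Bernoulli
measure `μ = (δ₋₁ + δ₁)/2`, whose F-transform is `F(z) = z - 1/z`. -/
theorem berry_esseen_monotone_clt_bernoulli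
    (F : ℂ → ℂ) (hF : ∀ z : ℂ, F z = z - 1 / z)
    (μ : ℕ → Measure ℝ) (hprob : ∀ n, IsProbabilityMeasure (μ n))
    (hcauchy : ∀ n : ℕ, 1 ≤ n → ∀ z : ℂ, 0 < z.im →
      ∫ t, (z - (t : ℂ))⁻¹ ∂(μ n)
        = (Real.sqrt n : ℂ) / F^[n] ((Real.sqrt n : ℂ) * z))
    (n : ℕ) (hn : 12288 < n) :
    ∀ x : ℝ, |cdfOf (μ n) x - cdfOf arcsine x| ≤ 200 * (n : ℝ) ^ (-(1 : ℝ) / 4) := by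
  intro x
  have := hprob n
  have hn' : (12288 : ℝ) < n := by exact_mod_cast hn
  have hr : (100 : ℝ) ≤ √n := Real.le_sqrt_of_sq_le (by linarith)
  set y : ℝ := 1 / √n with hydef
  have hy : 0 < y := by positivity
  have hy1 : y ≤ 1 / 100 := one_div_le_one_div_of_le (by norm_num) hr
  have hny : √n * y = 1 := mul_one_div_cancel (by positivity)
  have hC : ∀ x : ℝ, ∫ t, ((x + y * I : ℂ) - (t : ℂ))⁻¹ ∂(μ n) =
      (√n : ℂ) / F^[n] ((√n : ℂ) * (x + y * I)) := fun x =>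
    hcauchy n (by omega) _ (by simpa using hy)
  have hsymm := smoothedCDF_neg (μ n) hy fun x => by
    rw [hC, hC]
    have e : (√n : ℂ) * ((-x : ℝ) + y * I) =
        -(starRingEnd ℂ) ((√n : ℂ) * (x + y * I)) := by
      simp only [map_mul, map_add, conj_ofReal, conj_I]
      push_cast
      ring
    rw [e, iterate_neg_conj hF, div_neg, neg_im]
    generalize F^[n] ((√n : ℂ) * (x + y * I)) = Z
    have e2 : (√n : ℂ) / (starRingEnd ℂ) Z = (starRingEnd ℂ) ((√n : ℂ) / Z) := by
      simp only [map_div₀, conj_ofReal]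
    rw [e2, conj_im, neg_neg]
  have hS := abs_smoothedCDF_sub_le (μ n) hy hy1 (fun x hx => by
    rw [hC]
    exact scaled_iterate_sq_near hF hy hy1 hny hx) hsymm
  have hfin := abs_cdfOf_sub_arcsineCDF_le (μ n) hy hS x
  have hroot : √y = (n : ℝ) ^ (-(1 : ℝ) / 4) := by
    rw [hydef, one_div, Real.sqrt_eq_rpow, Real.sqrt_eq_rpow, ← Real.rpow_neg (by positivity),
      ← Real.rpow_mul (by positivity)]
    norm_num
  rw [cdfOf_arcsine, ← hroot]
  exact hfin.trans (by linarith [Real.sqrt_nonneg y])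
end

section
/- For each integer n ≥ 1, let μ_n be a probability measure on ℝ whose Cauchy transform satisfies ∫_ℝ (z − t)⁻¹ dμ_n(t) = 1 / (n^(−1/2) + √((z − n^(−1/2))² − 2)) for all z ∈ ℂ⁺. Then sup_{x ∈ ℝ} |C_{μ_n}(x) − C_γ(x)| ≥ 1/(√2 · π · n^(1/4)). (Consequently the O(n^(−1/4)) convergence rate in the monotone Berry–Esseen theorem cannot be improved in general.) -/
open MeasureTheory Complex Set Filter

/-- The branch of the complex square root analytic on `ℂ \ [0, ∞)`
with `√(-1) = i`. -/
noncomputable def sqrtC (z : ℂ) : ℂ := Complex.I * (-z) ^ ((1 : ℂ) / 2)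

lemma sqrtC_sq (z : ℂ) : sqrtC z ^ 2 = z := by
  have h := cpow_ofNat_inv_pow (-z) 2
  rw [sqrtC, one_div, mul_pow, h, I_sq]
  ring

lemma sqrtC_im_nonneg (z : ℂ) : 0 ≤ (sqrtC z).im := by
  rw [sqrtC, one_div, I_mul_im, cpow_inv_two_re]
  exact Real.sqrt_nonneg _

/-- The density of the arcsine distribution. -/
noncomputable def arcsineDensity (t : ℝ) : ℝ :=
  if t ^ 2 < 2 then (Real.pi * Real.sqrt (2 - t ^ 2))⁻¹ else 0

lemma arcsineDensity_nonneg (t : ℝ) : 0 ≤ arcsineDensity t := by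
  unfold arcsineDensity
  split_ifs <;> positivity

lemma hasDerivAt_arcsin_div_sqrt_two {t : ℝ} (ht : t ∈ Ioo (-√2) (√2)) :
    HasDerivAt (fun s => Real.arcsin (s / √2) / Real.pi) (arcsineDensity t) t := by
  have h2 : (0 : ℝ) < √2 := by positivity
  have hs2 : √2 ^ 2 = (2 : ℝ) := Real.sq_sqrt (by norm_num)
  have hlt : t ^ 2 < 2 := by nlinarith [ht.1, ht.2]
  have h1 : t / √2 ≠ -1 := by
    intro h
    rw [div_eq_iff h2.ne'] at h
    linarith [ht.1]
  have h1' : t / √2 ≠ 1 := by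
    intro h
    rw [div_eq_iff h2.ne'] at h
    linarith [ht.2]
  have h := ((Real.hasDerivAt_arcsin h1 h1').comp t ((hasDerivAt_id t).div_const (√2))).div_const
    Real.pi
  refine h.congr_deriv ?_
  rw [arcsineDensity, if_pos hlt]
  have hsq : √(2 - t ^ 2) = √2 * √(1 - (t / √2) ^ 2) := by
    rw [← Real.sqrt_mul (by norm_num), div_pow, hs2]
    congr 1
    ring
  rw [hsq]
  have h3 : 0 < √(1 - (t / √2) ^ 2) := by
    apply Real.sqrt_pos.2
    rw [div_pow, hs2]
    linarith
  field_simp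

lemma continuous_arcsin_div_sqrt_two :
    Continuous fun s : ℝ => Real.arcsin (s / √2) / Real.pi :=
  (Real.continuous_arcsin.comp (continuous_id.div_const _)).div_const _

lemma integrable_arcsineDensity : Integrable arcsineDensity := by
  have h : IntegrableOn arcsineDensity (Ioc (-√2) (√2)) :=
    intervalIntegral.integrableOn_deriv_of_nonneg
      continuous_arcsin_div_sqrt_two.continuousOn
      (fun t ht => hasDerivAt_arcsin_div_sqrt_two ht) (fun t _ => arcsineDensity_nonneg t)
  refine h.integrable_of_forall_notMem_eq_zero fun t ht => if_neg fun hlt => ht ?_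
  have h2 := abs_lt.1 (Real.lt_sqrt (abs_nonneg t) |>.2 ((sq_abs t).trans_lt hlt))
  exact ⟨h2.1, h2.2.le⟩

lemma arcsine_eq :
    arcsine = volume.withDensity fun t => ENNReal.ofReal (arcsineDensity t) := rfl

instance isFiniteMeasure_arcsine : IsFiniteMeasure arcsine := by
  rw [arcsine_eq]
  exact isFiniteMeasure_withDensity_ofReal integrable_arcsineDensity.2

lemma arcsin_le_cdfOf_arcsine {x : ℝ} (hx : -√2 ≤ x) (hx' : x ≤ √2) :
    (Real.arcsin (x / √2) + Real.pi / 2) / Real.pi ≤ cdfOf arcsine x := by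
  have hint : ∫ t in (-√2)..x, arcsineDensity t
      = Real.arcsin (x / √2) / Real.pi - Real.arcsin (-√2 / √2) / Real.pi :=
    intervalIntegral.integral_eq_sub_of_hasDerivAt_of_le hx
      continuous_arcsin_div_sqrt_two.continuousOn
      (fun t ht => hasDerivAt_arcsin_div_sqrt_two ⟨ht.1, ht.2.trans_le hx'⟩)
      integrable_arcsineDensity.intervalIntegrable
  have hm : arcsine.real (Ioc (-√2) x) = ∫ t in Ioc (-√2) x, arcsineDensity t := by
    rw [measureReal_def, arcsine_eq, withDensity_apply _ measurableSet_Ioc]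
    exact (integral_eq_lintegral_of_nonneg_ae (ae_of_all _ arcsineDensity_nonneg)
      integrable_arcsineDensity.1.restrict).symm
  have hle : arcsine.real (Ioc (-√2) x) ≤ arcsine.real (Iic x) :=
    measureReal_mono Ioc_subset_Iic_self
  rw [hm, ← intervalIntegral.integral_of_le hx, hint, neg_div,
    div_self (by positivity), Real.arcsin_neg_one] at hle
  refine le_trans (le_of_eq ?_) hle
  ring

/-- Poisson kernel estimate: the mass near `x` is controlled by the imaginary part of the Cauchy
transform above `x`. -/
lemma measureReal_Icc_le_cauchyTransform (ν : Measure ℝ) [IsProbabilityMeasure ν] (x : ℝ)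
    {y : ℝ} (hy : 0 < y) :
    ν.real (Icc (x - y) (x + y)) ≤
      2 * y * -(∫ t, ((⟨x, y⟩ : ℂ) - (t : ℂ))⁻¹ ∂ν).im := by
  have hne : ∀ t : ℝ, (⟨x, y⟩ : ℂ) - (t : ℂ) ≠ 0 := fun t h => by
    have := congrArg Complex.im h
    simp at this
    exact hy.ne' this
  have hcont : Continuous fun t : ℝ => ((⟨x, y⟩ : ℂ) - (t : ℂ))⁻¹ :=
    (continuous_const.sub continuous_ofReal).inv₀ hne
  have hint : Integrable (fun t : ℝ => ((⟨x, y⟩ : ℂ) - (t : ℂ))⁻¹) ν := by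
    refine Integrable.of_bound hcont.aestronglyMeasurable y⁻¹ (ae_of_all _ fun t => ?_)
    rw [norm_inv]
    refine inv_anti₀ hy ?_
    have := abs_im_le_norm ((⟨x, y⟩ : ℂ) - (t : ℂ))
    simpa [abs_of_pos hy] using this
  have him : (∫ t, ((⟨x, y⟩ : ℂ) - (t : ℂ))⁻¹ ∂ν).im
      = ∫ t, (((⟨x, y⟩ : ℂ) - (t : ℂ))⁻¹).im ∂ν := by
    simpa using (integral_im hint).symm
  have hkernel : ∀ t : ℝ, -(((⟨x, y⟩ : ℂ) - (t : ℂ))⁻¹).im = y / ((x - t) ^ 2 + y ^ 2) := by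
    intro t
    rw [inv_im, normSq_apply]
    simp
    ring
  rw [him, ← integral_neg, ← integral_const_mul]
  have hind : ν.real (Icc (x - y) (x + y))
      = ∫ t, (Icc (x - y) (x + y)).indicator (fun _ => (1 : ℝ)) t ∂ν := by
    rw [integral_indicator_const _ measurableSet_Icc]
    simp
  rw [hind]
  refine integral_mono ((integrable_const _).indicator measurableSet_Icc)
    ((hint.im.neg).const_mul _) fun t => ?_
  change _ ≤ 2 * y * -(((⟨x, y⟩ : ℂ) - (t : ℂ))⁻¹).im
  rw [hkernel]
  by_cases ht : t ∈ Icc (x - y) (x + y)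
  swap
  · rw [indicator_of_notMem ht]
    positivity
  rw [indicator_of_mem ht]
  rw [← mul_div_assoc, le_div_iff₀ (by positivity)]
  nlinarith [mul_nonneg (sub_nonneg.2 ht.1) (sub_nonneg.2 ht.2)]

/-- To the left of the zero of `a + √((z - a)² - 2)` the imaginary part of its reciprocal vanishes
linearly at the real line. -/
lemma neg_im_inv_le {a u y δ : ℝ} (ha : 0 < a) (hu : u < 0) (hδ : 0 < δ)
    (huδ : u ^ 2 - 2 - a ^ 2 = δ) (hy : 0 < y) (hyδ : y ^ 2 ≤ δ / 2) :
    -(((a : ℂ) + sqrtC ((⟨u, y⟩ : ℂ) ^ 2 - 2))⁻¹).im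
      ≤ -u / (a * (√(a ^ 2 + δ / 2) - a) ^ 2) * y := by
  set s := sqrtC ((⟨u, y⟩ : ℂ) ^ 2 - 2) with hs
  have hsq : s ^ 2 = (⟨u, y⟩ : ℂ) ^ 2 - 2 := sqrtC_sq _
  have hq0 : 0 ≤ s.im := sqrtC_im_nonneg _
  have hre : s.re ^ 2 - s.im ^ 2 = u ^ 2 - y ^ 2 - 2 := by
    have := congrArg Complex.re hsq
    simp [pow_two] at this
    linarith
  have him : s.re * s.im = u * y := by
    have := congrArg Complex.im hsq
    simp [pow_two] at this
    linarith
  have huy : u * y < 0 := mul_neg_of_neg_of_pos hu hy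
  have hp : s.re < 0 := by
    by_contra! h
    nlinarith [mul_nonneg h hq0]
  set r := √(a ^ 2 + δ / 2) with hr
  have hr2 : r ^ 2 = a ^ 2 + δ / 2 := Real.sq_sqrt (by positivity)
  have har : a < r := Real.lt_sqrt_of_sq_lt (by linarith)
  have hpr : r ≤ -s.re := Real.sqrt_le_iff.2 ⟨by linarith, by nlinarith [sq_nonneg s.im]⟩
  have hq : s.im ≤ -u * y / a := by
    rw [le_div_iff₀ ha]
    nlinarith
  have hnorm : (r - a) ^ 2 ≤ normSq ((a : ℂ) + s) := by
    rw [normSq_apply]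
    simp
    nlinarith
  have hra : 0 < (r - a) ^ 2 := by
    have : 0 < r - a := by linarith
    positivity
  rw [inv_im, neg_div, neg_neg]
  have : ((a : ℂ) + s).im = s.im := by simp
  rw [this]
  calc s.im / normSq ((a : ℂ) + s) ≤ (-u * y / a) / (r - a) ^ 2 :=
        div_le_div₀ (hq0.trans hq) hq hra hnorm
    _ = _ := by field_simp

lemma hasDerivAt_measureReal_Iic_zero (ν : Measure ℝ) [IsProbabilityMeasure ν] {x C y₀ : ℝ} (hy₀ : 0 < y₀)
    (h : ∀ y, 0 < y → y < y₀ → ν.real (Icc (x - y) (x + y)) ≤ C * y ^ 2) :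
    HasDerivAt (fun x => ν.real (Iic x)) 0 x := by
  have hO : (fun x' => ν.real (Iic x') - ν.real (Iic x)) =O[nhds x] fun x' => ‖x' - x‖ ^ 2 := by
    refine Asymptotics.IsBigO.of_bound C ?_
    filter_upwards [Metric.ball_mem_nhds x hy₀] with x' hx'
    rw [Metric.mem_ball, Real.dist_eq] at hx'
    rcases eq_or_ne x' x with rfl | hne
    · simp
    have hpos : 0 < |x' - x| := abs_pos.2 (sub_ne_zero.2 hne)
    have key := h _ hpos hx'
    rw [norm_pow, norm_norm, Real.norm_eq_abs, Real.norm_eq_abs]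
    refine le_trans ?_ key
    have hdiff : ∀ u v : ℝ, Iic v ⊆ Iic u ∪ Icc u v := fun u v t ht => by
      rcases le_total t u with h | h
      · exact Or.inl h
      · exact Or.inr ⟨h, ht⟩
    have hle : ∀ u v : ℝ, ν.real (Iic v) - ν.real (Iic u) ≤ ν.real (Icc u v) := fun u v => by
      have := (measureReal_mono (μ := ν) (hdiff u v)).trans (measureReal_union_le _ _)
      linarith
    have h1 := neg_abs_le (x' - x)
    have h2 := le_abs_self (x' - x)
    have h3 := abs_nonneg (x' - x)
    refine abs_le.2 ⟨?_, ?_⟩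
    · have := (hle x' x).trans (measureReal_mono (μ := ν)
        (Icc_subset_Icc (a₂ := x - |x' - x|) (b₂ := x + |x' - x|) (by linarith) (by linarith)))
      linarith
    · exact (hle x x').trans (measureReal_mono (μ := ν)
        (Icc_subset_Icc (by linarith) (by linarith)))
  have hF := hO.hasFDerivAt (𝕜 := ℝ) one_lt_two
  have hD := hF.hasDerivAt.add_const (ν.real (Iic x))
  simpa using hD

lemma measureReal_Iic_eq_zero (ν : Measure ℝ) [IsProbabilityMeasure ν] {a x₁ : ℝ} (ha : 0 < a)
    (hx₁ : x₁ < a) (hx₁a : a ^ 2 + 2 < (x₁ - a) ^ 2)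
    (hν : ∀ z : ℂ, 0 < z.im →
      ∫ t, (z - (t : ℂ))⁻¹ ∂ν = ((a : ℂ) + sqrtC ((z - (a : ℂ)) ^ 2 - 2))⁻¹) :
    ν.real (Iic x₁) = 0 := by
  have hderiv : ∀ x ∈ Iic x₁, HasDerivAt (fun x => ν.real (Iic x)) 0 x := by
    intro x hx
    rw [mem_Iic] at hx
    have hδ : 0 < (x - a) ^ 2 - 2 - a ^ 2 := by nlinarith
    set δ := (x - a) ^ 2 - 2 - a ^ 2 with hδdef
    refine hasDerivAt_measureReal_Iic_zero ν (C := 2 * (-(x - a) / (a * (√(a ^ 2 + δ / 2) - a) ^ 2)))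
      (Real.sqrt_pos.2 (half_pos hδ)) fun y hy hyδ => ?_
    have h1 := measureReal_Icc_le_cauchyTransform ν x hy
    rw [hν _ hy] at h1
    have hz : (⟨x, y⟩ : ℂ) - (a : ℂ) = ⟨x - a, y⟩ := by
      apply Complex.ext <;> simp
    rw [hz] at h1
    have h2 := neg_im_inv_le ha (by linarith : x - a < 0) hδ hδdef.symm hy
      ((Real.lt_sqrt hy.le).1 hyδ).le
    have h3 := h1.trans (mul_le_mul_of_nonneg_left h2 (by positivity : 0 ≤ 2 * y))
    linarith
  have hconst : ∀ x ∈ Iic x₁, ν.real (Iic x) = ν.real (Iic x₁) := by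
    intro x hx
    have := (convex_Iic x₁).norm_image_sub_le_of_norm_hasDerivWithin_le (C := 0)
      (fun x hx => (hderiv x hx).hasDerivWithinAt) (fun x _ => by simp) self_mem_Iic hx
    rw [zero_mul, norm_le_zero_iff, sub_eq_zero] at this
    exact this
  have hlim : Tendsto (fun x => ν.real (Iic x)) atBot (nhds 0) := by
    exact (ProbabilityTheory.tendsto_cdf_atBot ν).congr (ProbabilityTheory.cdf_eq_real ν)
  refine tendsto_nhds_unique (tendsto_const_nhds.congr' ?_) hlim
  filter_upwards [Iic_mem_atBot x₁] with x hx using (hconst x hx).symm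

lemma abs_cdfOf_sub_le_iSup (μ ν : Measure ℝ) [IsFiniteMeasure μ] [IsFiniteMeasure ν] (x : ℝ) :
    |cdfOf μ x - cdfOf ν x| ≤ ⨆ x : ℝ, |cdfOf μ x - cdfOf ν x| := by
  refine le_ciSup (f := fun x => |cdfOf μ x - cdfOf ν x|)
    ⟨μ.real univ + ν.real univ, ?_⟩ x
  rintro _ ⟨x, rfl⟩
  have h1 : cdfOf μ x ≤ μ.real univ := measureReal_mono (subset_univ _)
  have h2 : cdfOf ν x ≤ ν.real univ := measureReal_mono (subset_univ _)
  have h3 : 0 ≤ cdfOf μ x := ENNReal.toReal_nonneg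
  have h4 : 0 ≤ cdfOf ν x := ENNReal.toReal_nonneg
  exact abs_le.2 ⟨by linarith, by linarith⟩

/-- The `O(n^{-1/4})` rate in the monotone Berry–Esseen theorem is sharp:
for the measures `μ_n` with `F_{μ_n}(z) = n^{-1/2} + √((z - n^{-1/2})² - 2)`,
the Kolmogorov distance to the arcsine law is at least `1/(√2 π n^{1/4})`. -/
theorem monotone_berry_esseen_rate_sharp
    (μ : ℕ → Measure ℝ) (hprob : ∀ n, IsProbabilityMeasure (μ n))
    (hcauchy : ∀ n : ℕ, 1 ≤ n → ∀ z : ℂ, 0 < z.im →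
      ∫ t, (z - (t : ℂ))⁻¹ ∂(μ n)
        = ((((n : ℝ) ^ (-(1 : ℝ) / 2) : ℝ) : ℂ)
            + sqrtC ((z - (((n : ℝ) ^ (-(1 : ℝ) / 2) : ℝ) : ℂ)) ^ 2 - 2))⁻¹)
    (n : ℕ) (hn : 1 ≤ n) :
    1 / (Real.sqrt 2 * Real.pi * (n : ℝ) ^ ((1 : ℝ) / 4)) ≤
      ⨆ x : ℝ, |cdfOf (μ n) x - cdfOf arcsine x| := by
  have := hprob n
  have hn0 : (0 : ℝ) < n := by exact_mod_cast hn
  have hn1 : (1 : ℝ) ≤ n := by exact_mod_cast hn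
  have hμ := hcauchy n hn
  set a : ℝ := (n : ℝ) ^ (-(1 : ℝ) / 2) with ha
  have ha0 : 0 < a := by positivity
  have ha1 : a ≤ 1 := Real.rpow_le_one_of_one_le_of_nonpos hn1 (by norm_num)
  have h2 : √2 ^ 2 = (2 : ℝ) := Real.sq_sqrt (by norm_num)
  have h2pos : (0 : ℝ) < √2 := by positivity
  have h2gt : 1 < √2 := by nlinarith
  have hzero : cdfOf (μ n) (a / 2 - √2) = 0 :=
    measureReal_Iic_eq_zero (μ n) ha0 (by linarith) (by nlinarith) hμ
  refine le_trans ?_ (abs_cdfOf_sub_le_iSup (μ n) arcsine (a / 2 - √2))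
  rw [hzero, zero_sub, abs_neg]
  refine le_trans (le_trans ?_ (arcsin_le_cdfOf_arcsine (by linarith) (by linarith)))
    (le_abs_self _)
  set θ : ℝ := 1 / (√2 * (n : ℝ) ^ ((1 : ℝ) / 4)) with hθ
  have hθ0 : 0 < θ := by positivity
  have hθ2 : θ ^ 2 = a / 2 := by
    have h4 : ((n : ℝ) ^ ((1 : ℝ) / 4)) ^ 2 * a = 1 := by
      rw [ha, ← Real.rpow_natCast, ← Real.rpow_mul hn0.le, ← Real.rpow_add hn0]
      norm_num
    rw [hθ, div_pow, mul_pow, h2, div_eq_div_iff (by positivity) (by norm_num)]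
    linarith
  have hθ1 : θ ≤ 1 := by nlinarith
  have hπ := Real.pi_gt_three
  have harcsin : θ - Real.pi / 2 ≤ Real.arcsin ((a / 2 - √2) / √2) := by
    refine (Real.le_arcsin_iff_sin_le' ⟨by linarith, by linarith⟩).2 ?_
    rw [Real.sin_sub_pi_div_two, le_div_iff₀ h2pos]
    nlinarith [Real.one_sub_sq_div_two_le_cos (x := θ), sq_nonneg θ]
  calc 1 / (√2 * Real.pi * (n : ℝ) ^ ((1 : ℝ) / 4)) = θ / Real.pi := by
        rw [hθ]
        field_simp
    _ ≤ _ := by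
        gcongr
        linarith
end
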